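/- In the full shift (ℕ^ω, σ) over the countable alphabet ℕ, there exists a point x ∈ ℕ^ω such that ω(x) = {0̄, 1̄}, where 0̄ and 1̄ denote the constant sequences with value 0 and value 1 respectively; this set is closed and σ-invariant but is not internally chain transitive. -/

import Mathlib

open Set Filter Topology

/-- The shift map `σ` on `ℕ → Λ`, defined by `σ(x)(n) = x(n+1)`. -/
def shift {Λ : Type*} (x : ℕ → Λ) : ℕ → Λ := fun n => x (n + 1)

/-- The Baire metric `d(x,y) = inf {2^{-n} : x_i = y_i for all i < n}`. -/
noncomputable def bDist {Λ : Type*} (x y : ℕ → Λ) : ℝ :=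
  sInf {r : ℝ | ∃ n : ℕ, r = (2 : ℝ)⁻¹ ^ n ∧ ∀ i < n, x i = y i}

/-- `Γ` is a subshift: a closed, shift-invariant subset of `ℕ → Λ`. -/
def IsSubshift {Λ : Type*} [TopologicalSpace Λ] (Γ : Set (ℕ → Λ)) : Prop :=
  IsClosed Γ ∧ shift '' Γ = Γ

/-- The finite word `w` is allowed in `Γ`: it occurs as a consecutive block in some point of `Γ`. -/
def Allowed {Λ : Type*} (Γ : Set (ℕ → Λ)) (w : List Λ) : Prop :=
  ∃ x ∈ Γ, ∃ i : ℕ, ∀ (j : ℕ) (h : j < w.length), x (i + j) = w.get ⟨j, h⟩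

/-- `F` is a basis for the forbidden words of `Γ`: each member of `F` is forbidden, and every
forbidden word contains a member of `F` as a consecutive (infix) subword. -/
def IsForbiddenBasis {Λ : Type*} (Γ : Set (ℕ → Λ)) (F : Set (List Λ)) : Prop :=
  (∀ w ∈ F, ¬ Allowed Γ w) ∧ ∀ w : List Λ, ¬ Allowed Γ w → ∃ v ∈ F, v <:+: w

/-- `Γ` is a subshift of finite type: it has a finite basis for its forbidden words. -/
def IsSFT {Λ : Type*} (Γ : Set (ℕ → Λ)) : Prop :=
  ∃ F : Set (List Λ), F.Finite ∧ IsForbiddenBasis Γ F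

/-- `Γ` is a subshift of bounded type: it has a basis for its forbidden words whose members
have uniformly bounded length. -/
def IsSBT {Λ : Type*} (Γ : Set (ℕ → Λ)) : Prop :=
  ∃ F : Set (List Λ), (∃ N : ℕ, ∀ w ∈ F, w.length ≤ N) ∧ IsForbiddenBasis Γ F

/-- The ω-limit set of a sequence: `⋂_N cl {u i : i ≥ N}`. -/
def omegaSeq {X : Type*} [TopologicalSpace X] (u : ℕ → X) : Set X :=
  ⋂ N : ℕ, closure (u '' Set.Ici N)

/-- The ω-limit set of a point under the shift map. -/
def omegaPt {Λ : Type*} [TopologicalSpace Λ] (x : ℕ → Λ) : Set (ℕ → Λ) :=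
  omegaSeq fun i => shift^[i] x

/-- `A` is internally chain transitive for the shift (w.r.t. the Baire metric): for all
`a, b ∈ A` and `δ > 0` there is a `δ`-chain from `a` to `b` consisting of elements of `A`. -/
def IsICT {Λ : Type*} (A : Set (ℕ → Λ)) : Prop :=
  ∀ a ∈ A, ∀ b ∈ A, ∀ δ : ℝ, 0 < δ → ∃ n : ℕ, 1 ≤ n ∧
    ∃ c : ℕ → (ℕ → Λ), c 0 = a ∧ c n = b ∧ (∀ i ≤ n, c i ∈ A) ∧
      ∀ i < n, bDist (shift (c i)) (c (i + 1)) < δ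

theorem shift_iterate_apply {Λ : Type*} (x : ℕ → Λ) (i j : ℕ) : shift^[i] x j = x (i + j) := by
  induction i generalizing x with
  | zero => simp
  | succ i ih => rw [Function.iterate_succ_apply, ih, shift]; congr 1; omega

/-- A point lies in `ω(x)` iff each of its prefixes occurs in `x` arbitrarily far out. -/
theorem mem_omegaPt_iff {Λ : Type*} [TopologicalSpace Λ] [DiscreteTopology Λ] (x y : ℕ → Λ) :
    y ∈ omegaPt x ↔ ∀ N K : ℕ, ∃ i ≥ N, ∀ j < K, x (i + j) = y j := by
  simp only [omegaPt, omegaSeq, mem_iInter,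
    (PiNat.isTopologicalBasis_cylinders (fun _ => Λ)).mem_closure_iff]
  refine forall_congr' fun N => ⟨fun h K => ?_, ?_⟩
  · obtain ⟨z, hz, i, hi, rfl⟩ := h _ ⟨y, K, rfl⟩ (PiNat.self_mem_cylinder y K)
    exact ⟨i, hi, fun j hj => by simpa [shift_iterate_apply] using hz j hj⟩
  · rintro h _ ⟨z, K, rfl⟩ hy
    obtain ⟨i, hi, hx⟩ := h K
    refine ⟨shift^[i] x, fun j hj => ?_, i, hi, rfl⟩
    rw [shift_iterate_apply, hx j hj, hy j hj]

/-- The sequence whose entry at position `m ^ 2` is the marker `m + 2`, and which is constantly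
`m % 2` strictly between the positions `m ^ 2` and `(m + 1) ^ 2`. -/
def markedBlocks (n : ℕ) : ℕ :=
  if n.sqrt * n.sqrt = n then n.sqrt + 2 else n.sqrt % 2

theorem markedBlocks_of_mem_block {m j : ℕ} (hj : j < m) :
    markedBlocks (m * m + 1 + j) = m % 2 := by
  have h : (m * m + 1 + j).sqrt = m := by
    rw [add_assoc]; exact Nat.sqrt_add_eq m (by omega)
  rw [markedBlocks, h, if_neg (by omega)]

theorem markedBlocks_eq_mod_of_lt {M n : ℕ} (hn : M * M ≤ n) (h : markedBlocks n < M) :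
    n.sqrt * n.sqrt ≠ n ∧ markedBlocks n = n.sqrt % 2 := by
  have hM : M ≤ n.sqrt := Nat.le_sqrt.2 hn
  unfold markedBlocks at h ⊢
  split_ifs at h ⊢ with hs
  · omega
  · exact ⟨hs, rfl⟩

theorem sqrt_succ_eq_of_not_square {n : ℕ} (h : (n + 1).sqrt * (n + 1).sqrt ≠ n + 1) :
    (n + 1).sqrt = n.sqrt := by
  refine le_antisymm (Nat.le_sqrt.2 ?_) (Nat.sqrt_le_sqrt n.le_succ)
  have := Nat.sqrt_le (n + 1)
  omega

theorem const_mod_two_mem_omegaPt_markedBlocks (a : ℕ) :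
    (fun _ => a % 2) ∈ omegaPt markedBlocks := by
  refine (mem_omegaPt_iff _ _).2 fun N K => ?_
  set m := 2 * (N + K) + a with hm
  refine ⟨m * m + 1, by nlinarith, fun j hj => ?_⟩
  rw [markedBlocks_of_mem_block (by omega)]
  omega

theorem omegaPt_markedBlocks :
    omegaPt markedBlocks = ({fun _ => 0, fun _ => 1} : Set (ℕ → ℕ)) := by
  ext y
  constructor
  · intro hy
    rw [mem_omegaPt_iff] at hy
    have key : ∀ j, y j < 2 ∧ y (j + 1) = y j := by
      intro j
      set M := y j + y (j + 1) + 1 with hM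
      obtain ⟨i, hi, hx⟩ := hy (M * M) (j + 2)
      have h0 := hx j (by omega)
      have h1 := hx (j + 1) (by omega)
      rw [← add_assoc] at h1
      obtain ⟨-, e0⟩ := markedBlocks_eq_mod_of_lt (M := M) (n := i + j) (by omega) (by omega)
      obtain ⟨s1, e1⟩ := markedBlocks_eq_mod_of_lt (M := M) (n := i + j + 1) (by omega) (by omega)
      rw [sqrt_succ_eq_of_not_square s1] at e1
      omega
    have hc : ∀ j, y j = y 0 := fun j => by
      induction j with
      | zero => rfl
      | succ j ih => rw [(key j).2, ih]
    have h2 := (key 0).1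
    rcases (by omega : y 0 = 0 ∨ y 0 = 1) with h | h
    · exact Or.inl (funext fun j => (hc j).trans h)
    · exact Or.inr (funext fun j => (hc j).trans h)
  · rintro (rfl | rfl)
    · exact const_mod_two_mem_omegaPt_markedBlocks 0
    · exact const_mod_two_mem_omegaPt_markedBlocks 1

theorem bDist_eq_one_of_zero_ne {Λ : Type*} {x y : ℕ → Λ} (h : x 0 ≠ y 0) : bDist x y = 1 := by
  have : {r : ℝ | ∃ n : ℕ, r = (2 : ℝ)⁻¹ ^ n ∧ ∀ i < n, x i = y i} = {1} := by
    ext r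
    constructor
    · rintro ⟨n, rfl, hn⟩
      rcases n.eq_zero_or_pos with rfl | hpos
      · simp
      · exact absurd (hn 0 hpos) h
    · rintro rfl
      exact ⟨0, by simp, by simp⟩
  rw [bDist, this, csInf_singleton]

theorem not_isICT_pair_const {Λ : Type*} {a b : Λ} (hab : a ≠ b) :
    ¬ IsICT ({fun _ => a, fun _ => b} : Set (ℕ → Λ)) := by
  intro h
  obtain ⟨n, -, c, h0, hn, hA, hc⟩ := h _ (Or.inl rfl) _ (Or.inr rfl) 1 one_pos
  have key : ∀ i ≤ n, c i = fun _ => a := by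
    intro i
    induction i with
    | zero => exact fun _ => h0
    | succ i ih =>
      intro hi
      refine (hA _ hi).resolve_right fun hb => ?_
      have hb : c (i + 1) = fun _ => b := hb
      have hlt := hc i hi
      rw [ih (by omega), hb, bDist_eq_one_of_zero_ne (by simpa [shift] using hab)] at hlt
      exact lt_irrefl _ hlt
  exact hab (congrFun ((key n le_rfl).symm.trans hn) 0)

/-- In the full shift over the alphabet `ℕ`, there is a point `x` with
`ω(x) = {0̄, 1̄}`; this set is closed and `σ`-invariant but not internally chain
transitive. -/
theorem omega_two_points_not_ict :
    ∃ x : ℕ → ℕ, omegaPt x = ({fun _ => 0, fun _ => 1} : Set (ℕ → ℕ)) ∧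
      IsClosed ({fun _ => 0, fun _ => 1} : Set (ℕ → ℕ)) ∧
      shift '' ({fun _ => 0, fun _ => 1} : Set (ℕ → ℕ)) =
        ({fun _ => 0, fun _ => 1} : Set (ℕ → ℕ)) ∧
      ¬ IsICT ({fun _ => 0, fun _ => 1} : Set (ℕ → ℕ)) := by
  refine ⟨markedBlocks, omegaPt_markedBlocks, (Set.toFinite _).isClosed, ?_,
    not_isICT_pair_const zero_ne_one⟩
  rw [image_pair]
  rfl
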